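/- Let $(M,g)$ be a smooth Riemannian manifold (without boundary) of dimension $n\ge 3$, with Levi-Civita connection $\nabla$, and curvature tensor $R(X,Y)Z=\nabla_X\nabla_YZ-\nabla_Y\nabla_XZ-\nabla_{[X,Y]}Z$. For $X\in T_xM$ let $X^h$ and $X^v$ denote its horizontal lift (with respect to the horizontal distribution of $\nabla$) and its vertical lift at a point $(x,y)\in TM$; in the coordinates $(x^i,y^i)$ of $TM$ induced by coordinates $(x^i)$ of $M$, $X^v=X^i\frac{\partial}{\partial y^i}$ and $X^h=X^i\bigl(\frac{\partial}{\partial x^i}-y^a\Gamma_{ai}^j\frac{\partial}{\partial y^j}\bigr)$, where $\Gamma_{ai}^j$ are the Christoffel symbols of $\nabla$. Let $a,b,c\in\mathbb{R}$ satisfy $a>0$ and $a(a+c)-b^2>0$, and let $G=a g^s+b g^h+c g^v$ be the Riemannian metric on $TM$ given by $$G(X^h,Y^h)=(a+c)\,g(X,Y),\qquad G(X^h,Y^v)=G(X^v,Y^h)=b\,g(X,Y),\qquad G(X^v,Y^v)=a\,g(X,Y).$$ Suppose that $(TM,G)$ is weakly symmetric with associated smooth 1-forms $\alpha_1,\alpha_2$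 on $TM$, that is, the Levi-Civita connection $\widetilde\nabla$ and the curvature tensor $\widetilde R$ of $G$ satisfy, for all vector fields $X,Y,Z,W$ on $TM$, $$(\widetilde\nabla_W\widetilde R)(X,Y)Z=\alpha_1(W)\widetilde R(X,Y)Z+\alpha_2(X)\widetilde R(W,Y)Z+\alpha_2(Y)\widetilde R(X,W)Z+\alpha_2(Z)\widetilde R(X,Y)W+G(\widetilde R(X,Y)Z,W)\,\alpha_2^\sharp,$$ where $\alpha_2^\sharp$ is the vector field $G$-dual to $\alpha_2$. Then for every point $(x,y)\in TM$ and all $X,W\in T_xM$, $$\alpha_2(y^v)\,R(X,W)y=0,$$ where $y^v$ is the vertical lift of $y$ at the point $(x,y)$. -/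

import Mathlib

open scoped Manifold ContDiff

set_option maxSynthPendingDepth 3

noncomputable section

namespace RiemGeom

/-! ### Local formulas: a metric on an open subset of a vector space -/

section Local

variable {F : Type*} [NormedAddCommGroup F] [NormedSpace ℝ F]

/-- The Christoffel symbols of the first kind of a metric `h` on (an open subset of) `F`:
`(u, v, w) ↦ ½ (∂_u h(v,w) + ∂_v h(u,w) - ∂_w h(u,v))`, see `christoffelFirst_apply`. -/
def christoffelFirst (h : F → F →L[ℝ] F →L[ℝ] ℝ) (z : F) : F →L[ℝ] F →L[ℝ] F →L[ℝ] ℝ :=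
  let D : F →L[ℝ] F →L[ℝ] F →L[ℝ] ℝ := fderiv ℝ h z
  let flipL : (F →L[ℝ] F →L[ℝ] ℝ) →L[ℝ] F →L[ℝ] F →L[ℝ] ℝ :=
    (ContinuousLinearMap.flipₗᵢ ℝ F F ℝ).toContinuousLinearEquiv
  let D' : F →L[ℝ] F →L[ℝ] F →L[ℝ] ℝ := flipL ∘L D.flip
  (1 / 2 : ℝ) • (D + D.flip - D')

theorem christoffelFirst_apply (h : F → F →L[ℝ] F →L[ℝ] ℝ) (z u v w : F) :
    christoffelFirst h z u v w =
      1 / 2 * (fderiv ℝ h z u v w + fderiv ℝ h z v u w - fderiv ℝ h z w u v) := by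
  simp [christoffelFirst]

/-- The Christoffel symbols `Γ_z(u, v) = ∇_u v` (for constant vector fields `u`, `v`) of the
Levi-Civita connection of `h`: the vector `Γ_z(u, v)` is the `h z`-dual of the covector
`christoffelFirst h z u v`. -/
def christoffel (h : F → F →L[ℝ] F →L[ℝ] ℝ) (z : F) : F →L[ℝ] F →L[ℝ] F :=
  (ContinuousLinearMap.compL ℝ F (F →L[ℝ] ℝ) F (h z).inverse) ∘L christoffelFirst h z

theorem christoffel_apply (h : F → F →L[ℝ] F →L[ℝ] ℝ) (z u v : F) :
    christoffel h z u v = (h z).inverse (christoffelFirst h z u v) :=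
  rfl

/-- The curvature tensor `R(u,v)w = ∇_u ∇_v w - ∇_v ∇_u w` (for constant vector fields `u`, `v`,
`w`, for which `[u, v] = 0`) of the Levi-Civita connection of `h` at `z`. -/
def localCurvature (h : F → F →L[ℝ] F →L[ℝ] ℝ) (z u v w : F) : F :=
  fderiv ℝ (fun z' => christoffel h z' v w) z u - fderiv ℝ (fun z' => christoffel h z' u w) z v
    + christoffel h z u (christoffel h z v w) - christoffel h z v (christoffel h z u w)

/-- The covariant derivative
`(∇_s R)(u,v)w = ∇_s (R(u,v)w) - R(∇_s u,v)w - R(u,∇_s v)w - R(u,v)∇_s w`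
(for constant vector fields `s`, `u`, `v`, `w`) of the curvature tensor of `h` at `z`. -/
def localCovDerivCurvature (h : F → F →L[ℝ] F →L[ℝ] ℝ) (z s u v w : F) : F :=
  fderiv ℝ (fun z' => localCurvature h z' u v w) z s
    + christoffel h z s (localCurvature h z u v w)
    - localCurvature h z (christoffel h z s u) v w
    - localCurvature h z u (christoffel h z s v) w
    - localCurvature h z u v (christoffel h z s w)

end Local

/-! ### Curvature and weak symmetry on a manifold without boundary

In Mathlib the tangent space `TangentSpace I p` is the model space `E`, a tangent vector at `p`
being identified with its coordinates in the preferred chart `extChartAt I p` at `p`.  Hence the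
value at `p` of a tensor on the manifold is the value at `extChartAt I p p` of its coordinate
expression in that chart. -/

section Manifold

variable {E : Type*} [NormedAddCommGroup E] [NormedSpace ℝ E]
  {H : Type*} [TopologicalSpace H] (I : ModelWithCorners ℝ E H)
  {N : Type*} [TopologicalSpace N] [ChartedSpace H N]

/-- The coordinate expression, in the preferred chart `φ` at `p`, of a field `h` of bilinear forms
on the tangent spaces: `z ↦ ((u, v) ↦ h_{φ⁻¹ z} (d(φ⁻¹)_z u, d(φ⁻¹)_z v))`. -/
def inChart (h : ∀ q : N, TangentSpace I q →L[ℝ] TangentSpace I q →L[ℝ] ℝ) (p : N) (z : E) :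
    E →L[ℝ] E →L[ℝ] ℝ :=
  ContinuousLinearMap.bilinearComp (E := E) (F := E) (h ((extChartAt I p).symm z))
    (mfderiv 𝓘(ℝ, E) I (extChartAt I p).symm z) (mfderiv 𝓘(ℝ, E) I (extChartAt I p).symm z)

/-- The Christoffel symbols at `p`, in the preferred chart at `p`, of the Levi-Civita connection of
the metric `h`. -/
def christoffelAt (h : ∀ q : N, TangentSpace I q →L[ℝ] TangentSpace I q →L[ℝ] ℝ) (p : N) :
    E →L[ℝ] E →L[ℝ] E :=
  christoffel (inChart I h p) (extChartAt I p p)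

/-- The Riemann curvature tensor `R(X,Y)Z` at `p` of the metric `h`, with the sign convention
`R(X,Y)Z = ∇_X ∇_Y Z - ∇_Y ∇_X Z - ∇_{[X,Y]} Z`. -/
def curvature (h : ∀ q : N, TangentSpace I q →L[ℝ] TangentSpace I q →L[ℝ] ℝ) (p : N)
    (X Y Z : TangentSpace I p) : TangentSpace I p :=
  localCurvature (F := E) (inChart I h p) (extChartAt I p p) X Y Z

/-- The covariant derivative `(∇_W R)(X,Y)Z` at `p` of the Riemann curvature tensor of `h`. -/
def covDerivCurvature (h : ∀ q : N, TangentSpace I q →L[ℝ] TangentSpace I q →L[ℝ] ℝ) (p : N)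
    (W X Y Z : TangentSpace I p) : TangentSpace I p :=
  localCovDerivCurvature (F := E) (inChart I h p) (extChartAt I p p) W X Y Z

/-- The vector `h`-dual to the covector `θ` at `p`. -/
def sharp (h : ∀ q : N, TangentSpace I q →L[ℝ] TangentSpace I q →L[ℝ] ℝ) (p : N)
    (θ : TangentSpace I p →L[ℝ] ℝ) : TangentSpace I p :=
  (h p).inverse θ

/-- A smooth 1-form on `N`. -/
def IsSmoothOneForm [IsManifold I 1 N] (θ : ∀ q : N, TangentSpace I q →L[ℝ] ℝ) : Prop :=
  ContMDiff I (I.prod 𝓘(ℝ, E →L[ℝ] ℝ)) ∞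
    (fun q => Bundle.TotalSpace.mk' (E →L[ℝ] ℝ)
      (E := fun q : N => TangentSpace I q →L[ℝ] Bundle.Trivial N ℝ q) q (θ q))

/-- `(N, h)` is weakly symmetric with associated (smooth) 1-forms `α₁`, `α₂`. -/
structure IsWeaklySymmetric [IsManifold I 1 N]
    (h : ∀ q : N, TangentSpace I q →L[ℝ] TangentSpace I q →L[ℝ] ℝ)
    (α₁ α₂ : ∀ q : N, TangentSpace I q →L[ℝ] ℝ) : Prop where
  smooth₁ : IsSmoothOneForm I α₁
  smooth₂ : IsSmoothOneForm I α₂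
  eqn : ∀ (p : N) (X Y Z W : TangentSpace I p),
    covDerivCurvature I h p W X Y Z =
      α₁ p W • curvature I h p X Y Z + α₂ p X • curvature I h p W Y Z
        + α₂ p Y • curvature I h p X W Z + α₂ p Z • curvature I h p X Y W
        + h p (curvature I h p X Y Z) W • sharp I h p (α₂ p)

end Manifold

/-! ### The tangent bundle and the metric `G = a gˢ + b gʰ + c gᵛ`

The preferred chart of `TM` at `p = (x, y)` is the chart `(xⁱ, yⁱ)` induced by the preferred chart
`(xⁱ)` of `M` at `x`, so a tangent vector at `p` is a pair `(u, v) : E × E`, standing for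
`uⁱ ∂/∂xⁱ + vⁱ ∂/∂yⁱ`. -/

section TangentBundle

variable {E : Type*} [NormedAddCommGroup E] [NormedSpace ℝ E]
  {H : Type*} [TopologicalSpace H] (I : ModelWithCorners ℝ E H)
  {M : Type*} [TopologicalSpace M] [ChartedSpace H M] [IsManifold I 1 M]
  (g : ∀ x : M, TangentSpace I x →L[ℝ] TangentSpace I x →L[ℝ] ℝ)

/-- The vertical lift `Xᵛ = Xⁱ ∂/∂yⁱ` at `p`. -/
def vlift (p : TangentBundle I M) (X : TangentSpace I p.proj) : TangentSpace I.tangent p :=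
  ((0, X) : E × E)

/-- The horizontal lift `Xʰ = Xⁱ (∂/∂xⁱ - yᵃ Γ_{ai}^j ∂/∂yʲ)` at `p = (x, y)`. -/
def hlift (p : TangentBundle I M) (X : TangentSpace I p.proj) : TangentSpace I.tangent p :=
  ((X, -christoffelAt I g p.proj X p.snd) : E × E)

/-- The differential at `p` of the projection `TM → M`, in coordinates `(u, v) ↦ u`. -/
def horizPart (p : TangentBundle I M) : TangentSpace I.tangent p →L[ℝ] TangentSpace I p.proj :=
  ContinuousLinearMap.fst ℝ E E

/-- The connection map at `p = (x, y)`, in coordinates `(u, v) ↦ v + Γ(u, y)`; every tangent vector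
`ξ` at `p` is `(horizPart ξ)ʰ + (vertPart ξ)ᵛ`. -/
def vertPart (p : TangentBundle I M) : TangentSpace I.tangent p →L[ℝ] TangentSpace I p.proj :=
  ContinuousLinearMap.snd ℝ E E +
    ((christoffelAt I g p.proj).flip p.snd) ∘L ContinuousLinearMap.fst ℝ E E

theorem hlift_add_vlift (p : TangentBundle I M) (ξ : TangentSpace I.tangent p) :
    hlift I g p (horizPart I p ξ) + vlift I p (vertPart I g p ξ) = ξ := by
  refine Prod.ext ?_ ?_
  · change ξ.1 + 0 = ξ.1
    simp
  · change -christoffelAt I g p.proj ξ.1 p.snd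
      + (ξ.2 + christoffelAt I g p.proj ξ.1 p.snd) = ξ.2
    abel

theorem horizPart_hlift (p : TangentBundle I M) (X : TangentSpace I p.proj) :
    horizPart I p (hlift I g p X) = X :=
  rfl

theorem horizPart_vlift (p : TangentBundle I M) (X : TangentSpace I p.proj) :
    horizPart I p (vlift I p X) = 0 :=
  rfl

theorem vertPart_hlift (p : TangentBundle I M) (X : TangentSpace I p.proj) :
    vertPart I g p (hlift I g p X) = 0 := by
  change -christoffelAt I g p.proj X p.snd + christoffelAt I g p.proj X p.snd = (0 : E)
  simp

theorem vertPart_vlift (p : TangentBundle I M) (X : TangentSpace I p.proj) :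
    vertPart I g p (vlift I p X) = X := by
  have h : ∀ u y : E, u + christoffelAt I g p.proj 0 y = u := by simp
  exact h X p.snd

/-- The Sasaki lift `gˢ`. -/
def sasakiLift (p : TangentBundle I M) :
    TangentSpace I.tangent p →L[ℝ] TangentSpace I.tangent p →L[ℝ] ℝ :=
  ContinuousLinearMap.bilinearComp (E := E) (F := E) (E' := E × E) (F' := E × E) (g p.proj)
      (horizPart I p) (horizPart I p)
    + ContinuousLinearMap.bilinearComp (E := E) (F := E) (E' := E × E) (F' := E × E) (g p.proj)
      (vertPart I g p) (vertPart I g p)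

/-- The horizontal lift `gʰ` of the metric. -/
def horizontalLift (p : TangentBundle I M) :
    TangentSpace I.tangent p →L[ℝ] TangentSpace I.tangent p →L[ℝ] ℝ :=
  ContinuousLinearMap.bilinearComp (E := E) (F := E) (E' := E × E) (F' := E × E) (g p.proj)
      (horizPart I p) (vertPart I g p)
    + ContinuousLinearMap.bilinearComp (E := E) (F := E) (E' := E × E) (F' := E × E) (g p.proj)
      (vertPart I g p) (horizPart I p)

/-- The vertical lift `gᵛ` of the metric. -/
def verticalLift (p : TangentBundle I M) :
    TangentSpace I.tangent p →L[ℝ] TangentSpace I.tangent p →L[ℝ] ℝ :=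
  ContinuousLinearMap.bilinearComp (E := E) (F := E) (E' := E × E) (F' := E × E) (g p.proj)
      (horizPart I p) (horizPart I p)

/-- The `g`-natural metric `G = a gˢ + b gʰ + c gᵛ`. -/
def gNatural (a b c : ℝ) (p : TangentBundle I M) :
    TangentSpace I.tangent p →L[ℝ] TangentSpace I.tangent p →L[ℝ] ℝ :=
  a • sasakiLift I g p + b • horizontalLift I g p + c • verticalLift I g p

theorem gNatural_apply (a b c : ℝ) (p : TangentBundle I M) (ξ η : TangentSpace I.tangent p) :
    gNatural I g a b c p ξ η =
      (a + c) * g p.proj (horizPart I p ξ) (horizPart I p η)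
        + b * (g p.proj (horizPart I p ξ) (vertPart I g p η)
            + g p.proj (vertPart I g p ξ) (horizPart I p η))
        + a * g p.proj (vertPart I g p ξ) (vertPart I g p η) := by
  change a * (g p.proj (horizPart I p ξ) (horizPart I p η)
        + g p.proj (vertPart I g p ξ) (vertPart I g p η))
      + b * (g p.proj (horizPart I p ξ) (vertPart I g p η)
        + g p.proj (vertPart I g p ξ) (horizPart I p η))
      + c * g p.proj (horizPart I p ξ) (horizPart I p η) = _
  ring

/-- The values of `G` on lifts. -/
theorem gNatural_lifts (a b c : ℝ) (p : TangentBundle I M) (X Y : TangentSpace I p.proj) :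
    gNatural I g a b c p (hlift I g p X) (hlift I g p Y) = (a + c) * g p.proj X Y ∧
    gNatural I g a b c p (hlift I g p X) (vlift I p Y) = b * g p.proj X Y ∧
    gNatural I g a b c p (vlift I p X) (hlift I g p Y) = b * g p.proj X Y ∧
    gNatural I g a b c p (vlift I p X) (vlift I p Y) = a * g p.proj X Y := by
  simp only [gNatural_apply, horizPart_hlift, horizPart_vlift, vertPart_hlift, vertPart_vlift]
  simp

end TangentBundle

end RiemGeom

end

namespace RiemGeom

section LocalMetric

variable {F : Type*} [NormedAddCommGroup F] [NormedSpace ℝ F]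

/-- `h` is a smooth Riemannian metric on the open set `U`. -/
structure IsMetricOn (h : F → F →L[ℝ] F →L[ℝ] ℝ) (U : Set F) : Prop where
  isOpen : IsOpen U
  contDiffOn : ContDiffOn ℝ ∞ h U
  symm : ∀ x ∈ U, ∀ u v, h x u v = h x v u
  pos : ∀ x ∈ U, ∀ u, u ≠ 0 → 0 < h x u u

theorem isInvertible_of_pos [FiniteDimensional ℝ F] (B : F →L[ℝ] F →L[ℝ] ℝ)
    (hB : ∀ u, u ≠ 0 → 0 < B u u) : B.IsInvertible := by
  have hinj : Function.Injective (B : F →ₗ[ℝ] F →L[ℝ] ℝ) := by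
    rw [← LinearMap.ker_eq_bot, LinearMap.ker_eq_bot']
    intro u hu
    by_contra hne
    have h1 := hB u hne
    have h2 : B u = 0 := hu
    simp [h2] at h1
  have hfin : Module.finrank ℝ F = Module.finrank ℝ (F →L[ℝ] ℝ) := by
    rw [← (LinearMap.toContinuousLinearMap (𝕜 := ℝ) (E := F) (F' := ℝ)).finrank_eq]
    exact Subspace.dual_finrank_eq.symm
  let e := (LinearMap.linearEquivOfInjective (B : F →ₗ[ℝ] F →L[ℝ] ℝ) hinj hfin)
  exact ⟨e.toContinuousLinearEquiv, by ext; rfl⟩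

namespace IsMetricOn

variable {h : F → F →L[ℝ] F →L[ℝ] ℝ} {U : Set F} {x : F}

theorem contDiffAt (hh : IsMetricOn h U) (hx : x ∈ U) : ContDiffAt ℝ ∞ h x :=
  hh.contDiffOn.contDiffAt (hh.isOpen.mem_nhds hx)

theorem differentiableAt (hh : IsMetricOn h U) (hx : x ∈ U) : DifferentiableAt ℝ h x :=
  (hh.contDiffAt hx).differentiableAt (by simp)

theorem eq_zero_of_forall (hh : IsMetricOn h U) (hx : x ∈ U) {u : F} (hu : ∀ v, h x u v = 0) :
    u = 0 := by
  by_contra hne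
  exact (hh.pos x hx u hne).ne' (hu u)

theorem eq_of_forall (hh : IsMetricOn h U) (hx : x ∈ U) {u u' : F}
    (hu : ∀ v, h x u v = h x u' v) : u = u' :=
  sub_eq_zero.1 (hh.eq_zero_of_forall hx fun v => by simp [hu v])

theorem fderiv_symm (hh : IsMetricOn h U) (hx : x ∈ U) (s u v : F) :
    fderiv ℝ h x s u v = fderiv ℝ h x s v u := by
  have hd := (hh.differentiableAt hx).hasFDerivAt
  have h1 : HasFDerivAt (fun z => h z u v) _ x := (hd.clm_apply (hasFDerivAt_const u x)).clm_apply
    (hasFDerivAt_const v x)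
  have h2 : HasFDerivAt (fun z => h z v u) _ x := (hd.clm_apply (hasFDerivAt_const v x)).clm_apply
    (hasFDerivAt_const u x)
  have h3 : (fun z => h z u v) =ᶠ[nhds x] fun z => h z v u := by
    filter_upwards [hh.isOpen.mem_nhds hx] with z hz using hh.symm z hz u v
  have := congrArg (fun L => L s) (h1.unique (h2.congr_of_eventuallyEq h3))
  simpa using this

theorem christoffelFirst_symm (hh : IsMetricOn h U) (hx : x ∈ U) (u v w : F) :
    christoffelFirst h x u v w = christoffelFirst h x v u w := by
  rw [christoffelFirst_apply, christoffelFirst_apply, hh.fderiv_symm hx w u v]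
  ring

variable [FiniteDimensional ℝ F]

theorem apply_inverse (hh : IsMetricOn h U) (hx : x ∈ U) (θ : F →L[ℝ] ℝ) :
    h x ((h x).inverse θ) = θ := by
  obtain ⟨e, he⟩ := isInvertible_of_pos (h x) (hh.pos x hx)
  rw [← he, ContinuousLinearMap.inverse_equiv]
  exact e.apply_symm_apply θ

theorem apply_christoffel (hh : IsMetricOn h U) (hx : x ∈ U) (u v w : F) :
    h x (christoffel h x u v) w = christoffelFirst h x u v w := by
  rw [christoffel_apply, hh.apply_inverse hx]

theorem christoffel_eq (hh : IsMetricOn h U) (hx : x ∈ U) {u v t : F}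
    (ht : ∀ w, h x t w = christoffelFirst h x u v w) : christoffel h x u v = t :=
  hh.eq_of_forall hx fun w => by rw [hh.apply_christoffel hx, ht]

theorem christoffel_symm (hh : IsMetricOn h U) (hx : x ∈ U) (u v : F) :
    christoffel h x u v = christoffel h x v u :=
  hh.christoffel_eq hx fun w => by rw [hh.apply_christoffel hx, hh.christoffelFirst_symm hx]

/-- Metric compatibility of the Levi-Civita connection. -/
theorem fderiv_apply (hh : IsMetricOn h U) (hx : x ∈ U) (s u v : F) :
    fderiv ℝ h x s u v = h x (christoffel h x s u) v + h x u (christoffel h x s v) := by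
  rw [hh.symm x hx u, hh.apply_christoffel hx, hh.apply_christoffel hx, christoffelFirst_apply,
    christoffelFirst_apply, hh.fderiv_symm hx s v u]
  ring

theorem contDiffOn_christoffel (hh : IsMetricOn h U) : ContDiffOn ℝ ∞ (christoffel h) U := by
  intro x hx
  refine ContDiffAt.contDiffWithinAt ?_
  have hD : ContDiffAt ℝ ∞ (fderiv ℝ h) x := (hh.contDiffAt hx).fderiv_right (by simp)
  have hfirst : ContDiffAt ℝ ∞ (christoffelFirst h) x := by
    have hflip : ContDiffAt ℝ ∞ (fun z => (fderiv ℝ h z).flip) x :=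
      ((ContinuousLinearMap.flipₗᵢ ℝ F F (F →L[ℝ] ℝ)).toContinuousLinearEquiv.contDiff
        ).contDiffAt.comp x hD
    exact ((hD.add hflip).sub (contDiffAt_const.clm_comp hflip)).const_smul (1 / 2 : ℝ)
  have hinv : ContDiffAt ℝ ∞ (fun z => (h z).inverse) x := by
    obtain ⟨e, he⟩ := isInvertible_of_pos (h x) (hh.pos x hx)
    have := contDiffAt_map_inverse (𝕜 := ℝ) (n := ∞) e
    rw [he] at this
    exact this.comp x (hh.contDiffAt hx)
  exact ((ContinuousLinearMap.compL ℝ F (F →L[ℝ] ℝ) F).contDiff.contDiffAt.comp x hinv).clm_comp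
    hfirst

theorem differentiableAt_christoffel (hh : IsMetricOn h U) (hx : x ∈ U) :
    DifferentiableAt ℝ (christoffel h) x :=
  (hh.contDiffOn_christoffel.contDiffAt (hh.isOpen.mem_nhds hx)).differentiableAt (by simp)

theorem fderiv_christoffel_apply (hh : IsMetricOn h U) (hx : x ∈ U) (s u v : F) :
    fderiv ℝ (fun z => christoffel h z u v) x s = fderiv ℝ (christoffel h) x s u v := by
  have hd := (hh.differentiableAt_christoffel hx).hasFDerivAt
  have h1 : HasFDerivAt (fun z => christoffel h z u v) _ x :=
    (hd.clm_apply (hasFDerivAt_const u x)).clm_apply (hasFDerivAt_const v x)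
  rw [h1.fderiv]
  simp

theorem localCurvature_eq (hh : IsMetricOn h U) (hx : x ∈ U) (u v w : F) :
    localCurvature h x u v w =
      fderiv ℝ (christoffel h) x u v w - fderiv ℝ (christoffel h) x v u w
        + christoffel h x u (christoffel h x v w) - christoffel h x v (christoffel h x u w) := by
  rw [localCurvature, hh.fderiv_christoffel_apply hx, hh.fderiv_christoffel_apply hx]

theorem differentiableAt_localCurvature (hh : IsMetricOn h U) (hx : x ∈ U) (u v w : F) :
    DifferentiableAt ℝ (fun z => localCurvature h z u v w) x := by
  have hΓ := hh.contDiffOn_christoffel.contDiffAt (hh.isOpen.mem_nhds hx)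
  have hD : DifferentiableAt ℝ (fderiv ℝ (christoffel h)) x :=
    (hΓ.fderiv_right (m := 1) (by norm_cast)).differentiableAt (by simp)
  have hΓ' := hh.differentiableAt_christoffel hx
  have h1 : DifferentiableAt ℝ (fun z => fderiv ℝ (christoffel h) z u v w
      - fderiv ℝ (christoffel h) z v u w + christoffel h z u (christoffel h z v w)
      - christoffel h z v (christoffel h z u w)) x := by fun_prop
  refine h1.congr_of_eventuallyEq ?_
  filter_upwards [hh.isOpen.mem_nhds hx] with z hz using hh.localCurvature_eq hz u v w

theorem apply_localCurvature_self (hh : IsMetricOn h U) (hx : x ∈ U) (u v y : F) :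
    h x (localCurvature h x u v y) y = 0 := by
  have key : ∀ u v : F, fderiv ℝ (fderiv ℝ h) x u v y y =
      2 * (h x (christoffel h x u (christoffel h x v y)) y
        + h x (christoffel h x v y) (christoffel h x u y)
        + h x (fderiv ℝ (christoffel h) x u v y) y) := by
    intro u v
    have hD : DifferentiableAt ℝ (fderiv ℝ h) x :=
      ((hh.contDiffAt hx).fderiv_right (m := 1) (by norm_cast)).differentiableAt (by simp)
    have hd := (hh.differentiableAt hx).hasFDerivAt
    have hΓ := (hh.differentiableAt_christoffel hx).hasFDerivAt
    have h1 : HasFDerivAt (fun z => fderiv ℝ h z v y y) _ x :=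
      ((hD.hasFDerivAt.clm_apply (hasFDerivAt_const v x)).clm_apply
        (hasFDerivAt_const y x)).clm_apply (hasFDerivAt_const y x)
    have h2 : HasFDerivAt (fun z => h z (christoffel h z v y) y) _ x :=
      (hd.clm_apply ((hΓ.clm_apply (hasFDerivAt_const v x)).clm_apply
        (hasFDerivAt_const y x))).clm_apply (hasFDerivAt_const y x)
    have h3 : (fun z => fderiv ℝ h z v y y) =ᶠ[nhds x]
        fun z => (2 : ℝ) • h z (christoffel h z v y) y := by
      filter_upwards [hh.isOpen.mem_nhds hx] with z hz
      rw [hh.fderiv_apply hz, hh.symm z hz y, smul_eq_mul]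
      ring
    have := congrArg (fun L => L u) (h1.unique ((h2.const_smul (2 : ℝ)).congr_of_eventuallyEq h3))
    simp only [add_apply, ContinuousLinearMap.comp_apply,
      ContinuousLinearMap.flip_apply, smul_apply,
      zero_apply, map_zero, zero_add, smul_eq_mul] at this
    rw [this, hh.fderiv_apply hx]
    ring
  have hsymm : fderiv ℝ (fderiv ℝ h) x u v = fderiv ℝ (fderiv ℝ h) x v u :=
    ((hh.contDiffAt hx).isSymmSndFDerivAt (by simp only [minSmoothness_of_isRCLikeNormedField]; norm_cast)).eq u v
  have h1 := key u v
  have h2 := key v u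
  rw [← hsymm] at h2
  rw [hh.localCurvature_eq hx]
  simp only [map_add, map_sub, add_apply, sub_apply]
  have h3 := hh.symm x hx (christoffel h x v y) (christoffel h x u y)
  linarith

theorem apply_localCurvature_skew (hh : IsMetricOn h U) (hx : x ∈ U) (u v y t : F) :
    h x (localCurvature h x u v y) t = -h x (localCurvature h x u v t) y := by
  have hadd : localCurvature h x u v (y + t) = localCurvature h x u v y
      + localCurvature h x u v t := by
    simp only [hh.localCurvature_eq hx, map_add]
    abel
  have h1 := hh.apply_localCurvature_self hx u v (y + t)
  rw [hadd] at h1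
  simp only [map_add, add_apply] at h1
  linarith [hh.apply_localCurvature_self hx u v y, hh.apply_localCurvature_self hx u v t]

end IsMetricOn

end LocalMetric

section LocalLift

variable {E : Type*} [NormedAddCommGroup E] [NormedSpace ℝ E]

theorem fderiv_apply_eq_of_cubic {F : Type*} [NormedAddCommGroup F] [NormedSpace ℝ F]
    {f : E → F} {z v : E} (hf : DifferentiableAt ℝ f z) {A₀ A₁ A₂ A₃ : F}
    (hA : ∀ s : ℝ, f (z + s • v) = A₀ + s • A₁ + s ^ 2 • A₂ + s ^ 3 • A₃) :
    fderiv ℝ f z v = A₁ := by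
  rw [← hf.lineDeriv_eq_fderiv]
  refine HasLineDerivAt.lineDeriv ?_
  rw [HasLineDerivAt]
  simp only [hA]
  have h1 := ((((hasDerivAt_id (0 : ℝ)).smul_const A₁).const_add A₀).add
    (((hasDerivAt_id (0 : ℝ)).pow 2).smul_const A₂)).add
    (((hasDerivAt_id (0 : ℝ)).pow 3).smul_const A₃)
  exact HasDerivAt.congr_deriv h1 (by simp)

/-- The expression in the coordinates `(xⁱ, yⁱ)` of the metric `a gˢ + b gʰ + c gᵛ`, where `h` is
the expression of `g` in the coordinates `(xⁱ)`. -/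
noncomputable def localGNatural (h : E → E →L[ℝ] E →L[ℝ] ℝ) (a b c : ℝ) (z : E × E) :
    E × E →L[ℝ] E × E →L[ℝ] ℝ :=
  let P := ContinuousLinearMap.fst ℝ E E
  let V := ContinuousLinearMap.snd ℝ E E + (christoffel h z.1).flip z.2 ∘L P
  (a + c) • (h z.1).bilinearComp P P + b • ((h z.1).bilinearComp P V + (h z.1).bilinearComp V P)
    + a • (h z.1).bilinearComp V V

theorem localGNatural_apply (h : E → E →L[ℝ] E →L[ℝ] ℝ) (a b c : ℝ) (z ξ η : E × E) :
    localGNatural h a b c z ξ η = (a + c) * h z.1 ξ.1 η.1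
      + b * (h z.1 ξ.1 (η.2 + christoffel h z.1 η.1 z.2)
        + h z.1 (ξ.2 + christoffel h z.1 ξ.1 z.2) η.1)
      + a * h z.1 (ξ.2 + christoffel h z.1 ξ.1 z.2) (η.2 + christoffel h z.1 η.1 z.2) :=
  rfl

/-- The lift `Xʰ - (b / a) Xᵛ`, which is orthogonal to the vertical vectors with respect to
`a gˢ + b gʰ + c gᵛ`, in coordinates. -/
noncomputable def perpLift (h : E → E →L[ℝ] E →L[ℝ] ℝ) (a b : ℝ) (x y : E) : E →L[ℝ] E × E :=
  (ContinuousLinearMap.id ℝ E).prod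
    (-(b / a) • ContinuousLinearMap.id ℝ E - (christoffel h x).flip y)

theorem perpLift_apply (h : E → E →L[ℝ] E →L[ℝ] ℝ) (a b : ℝ) (x y Z : E) :
    perpLift h a b x y Z = (Z, -(b / a) • Z - christoffel h x Z y) :=
  rfl

theorem perpLift_add_smul (h : E → E →L[ℝ] E →L[ℝ] ℝ) (a b s : ℝ) (x y w Z : E) :
    perpLift h a b x (y + s • w) Z = perpLift h a b x y Z - s • ((0 : E), christoffel h x Z w) := by
  simp only [perpLift_apply, map_add, map_smul]
  ext
  · simp
  · simp
    abel

/-- The vector dual to the covector `P ↦ -h(R(X,P)y, t)`; it is `R(t,y)X`. -/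
noncomputable def curvatureDual (h : E → E →L[ℝ] E →L[ℝ] ℝ) (x t y X : E) : E :=
  (h x).inverse (-(h x t ∘L ((fderiv ℝ (christoffel h) x X).flip y
    - ((fderiv ℝ (christoffel h) x).flip X).flip y
    + christoffel h x X ∘L (christoffel h x).flip y
    - (christoffel h x).flip (christoffel h x X y))))

namespace IsMetricOn

variable [FiniteDimensional ℝ E] {h : E → E →L[ℝ] E →L[ℝ] ℝ} {U : Set E} {x : E}

theorem apply_curvatureDual (hh : IsMetricOn h U) (hx : x ∈ U) (t y X P : E) :
    h x (curvatureDual h x t y X) P = -h x (localCurvature h x X P y) t := by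
  rw [curvatureDual, hh.apply_inverse hx, hh.symm x hx _ t, hh.localCurvature_eq hx]
  rfl

theorem curvatureDual_swap (hh : IsMetricOn h U) (hx : x ∈ U) (t y X : E) :
    curvatureDual h x t y X = -curvatureDual h x y t X :=
  hh.eq_of_forall hx fun P => by
    rw [hh.apply_curvatureDual hx, hh.apply_localCurvature_skew hx, map_neg, neg_apply,
      hh.apply_curvatureDual hx]

theorem curvatureDual_self (hh : IsMetricOn h U) (hx : x ∈ U) (y X : E) :
    curvatureDual h x y y X = 0 :=
  hh.eq_of_forall hx fun P => by
    rw [hh.apply_curvatureDual hx, hh.apply_localCurvature_self hx]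
    simp

theorem apply_curvatureDual_self (hh : IsMetricOn h U) (hx : x ∈ U) (t y X : E) :
    h x (curvatureDual h x t y X) X = 0 := by
  rw [hh.apply_curvatureDual hx, hh.localCurvature_eq hx]
  simp

theorem apply_curvatureDual_skew (hh : IsMetricOn h U) (hx : x ∈ U) (t y X P : E) :
    h x (curvatureDual h x t y X) P = -h x (curvatureDual h x t y P) X := by
  rw [hh.apply_curvatureDual hx, hh.apply_curvatureDual hx, hh.localCurvature_eq hx,
    hh.localCurvature_eq hx]
  simp only [map_add, map_sub, add_apply, sub_apply]
  ring

theorem curvatureDual_add_smul (hh : IsMetricOn h U) (hx : x ∈ U) (t y w X : E) (s : ℝ) :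
    curvatureDual h x t (y + s • w) X = curvatureDual h x t y X + s • curvatureDual h x t w X :=
  hh.eq_of_forall hx fun P => by
    simp only [map_add, map_smul, add_apply, smul_apply, hh.apply_curvatureDual hx,
      hh.localCurvature_eq hx, map_sub, sub_apply, smul_eq_mul]
    ring

theorem curvatureDual_apply_add_smul (hh : IsMetricOn h U) (hx : x ∈ U) (t y X Z : E) (s : ℝ) :
    curvatureDual h x t y (X + s • Z) = curvatureDual h x t y X + s • curvatureDual h x t y Z :=
  hh.eq_of_forall hx fun P => by
    simp only [map_add, map_smul, add_apply, smul_apply, hh.apply_curvatureDual hx,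
      hh.localCurvature_eq hx, map_sub, sub_apply, smul_eq_mul]
    ring

theorem curvatureDual_zero (hh : IsMetricOn h U) (hx : x ∈ U) (t y : E) :
    curvatureDual h x t y 0 = 0 := by
  simpa using hh.curvatureDual_apply_add_smul hx t y 0 0 1

theorem curvatureDual_smul (hh : IsMetricOn h U) (hx : x ∈ U) (t y Z : E) (s : ℝ) :
    curvatureDual h x t y (s • Z) = s • curvatureDual h x t y Z := by
  simpa [hh.curvatureDual_zero hx] using hh.curvatureDual_apply_add_smul hx t y 0 Z s

variable {a b c : ℝ}

theorem isMetricOn_localGNatural (hh : IsMetricOn h U) (ha : 0 < a)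
    (hα : 0 < a * (a + c) - b ^ 2) :
    IsMetricOn (localGNatural h a b c) (U ×ˢ (Set.univ : Set E)) where
  isOpen := hh.isOpen.prod isOpen_univ
  contDiffOn := by
    rw [contDiffOn_clm_apply]
    intro ξ
    rw [contDiffOn_clm_apply]
    intro η
    simp only [localGNatural_apply]
    have hfst : ContDiffOn ℝ ∞ (Prod.fst : E × E → E) (U ×ˢ (Set.univ : Set E)) :=
      contDiff_fst.contDiffOn
    have hsnd : ContDiffOn ℝ ∞ (Prod.snd : E × E → E) (U ×ˢ (Set.univ : Set E)) :=
      contDiff_snd.contDiffOn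
    have h1 : ContDiffOn ℝ ∞ (fun z : E × E => h z.1) (U ×ˢ (Set.univ : Set E)) :=
      hh.contDiffOn.comp hfst fun z hz => hz.1
    have h2 : ContDiffOn ℝ ∞ (fun z : E × E => christoffel h z.1) (U ×ˢ (Set.univ : Set E)) :=
      hh.contDiffOn_christoffel.comp hfst fun z hz => hz.1
    have h3 (ζ : E × E) : ContDiffOn ℝ ∞ (fun z : E × E => ζ.2 + christoffel h z.1 ζ.1 z.2)
        (U ×ˢ (Set.univ : Set E)) :=
      contDiffOn_const.add ((h2.clm_apply contDiffOn_const).clm_apply hsnd)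
    exact ((contDiffOn_const.mul ((h1.clm_apply contDiffOn_const).clm_apply contDiffOn_const)).add
      (contDiffOn_const.mul (((h1.clm_apply contDiffOn_const).clm_apply (h3 η)).add
        ((h1.clm_apply (h3 ξ)).clm_apply contDiffOn_const)))).add
      (contDiffOn_const.mul ((h1.clm_apply (h3 ξ)).clm_apply (h3 η)))
  symm := by
    rintro z ⟨hz, -⟩ ξ η
    rw [localGNatural_apply, localGNatural_apply, hh.symm _ hz ξ.1 η.1,
      hh.symm _ hz ξ.1 (η.2 + _), hh.symm _ hz (ξ.2 + _) η.1, hh.symm _ hz (ξ.2 + _) (η.2 + _)]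
    ring
  pos := by
    rintro z ⟨hz, -⟩ ξ hξ
    rw [localGNatural_apply]
    set K := ξ.2 + christoffel h z.1 ξ.1 z.2 with hK
    have hnonneg (u : E) : 0 ≤ h z.1 u u := by
      rcases eq_or_ne u 0 with rfl | hu
      · simp
      · exact (hh.pos _ hz u hu).le
    have hexp : h z.1 (b • ξ.1 + a • K) (b • ξ.1 + a • K) = b ^ 2 * h z.1 ξ.1 ξ.1
        + a * b * (h z.1 ξ.1 K + h z.1 K ξ.1) + a ^ 2 * h z.1 K K := by
      simp only [map_add, map_smul, add_apply, smul_apply, smul_eq_mul]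
      ring
    by_cases hX : ξ.1 = 0
    · have hK0 : K ≠ 0 := fun h0 => hξ (Prod.ext hX (by simpa [hK, hX] using h0))
      simpa [hX] using mul_pos ha (hh.pos _ hz K hK0)
    · have h1 := mul_pos hα (hh.pos _ hz _ hX)
      have h2 := hnonneg (b • ξ.1 + a • K)
      rw [hexp] at h2
      refine pos_of_mul_pos_right (a := a) ?_ ha.le
      nlinarith

theorem fderiv_localGNatural (hh : IsMetricOn h U) (ha : 0 < a) (hα : 0 < a * (a + c) - b ^ 2)
    (hx : x ∈ U) (y : E) (ζ ξ η : E × E) :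
    fderiv ℝ (localGNatural h a b c) (x, y) ζ ξ η =
      (a + c) * fderiv ℝ h x ζ.1 ξ.1 η.1
      + b * (fderiv ℝ h x ζ.1 ξ.1 (η.2 + christoffel h x η.1 y)
        + h x ξ.1 (fderiv ℝ (christoffel h) x ζ.1 η.1 y + christoffel h x η.1 ζ.2)
        + fderiv ℝ h x ζ.1 (ξ.2 + christoffel h x ξ.1 y) η.1
        + h x (fderiv ℝ (christoffel h) x ζ.1 ξ.1 y + christoffel h x ξ.1 ζ.2) η.1)
      + a * (fderiv ℝ h x ζ.1 (ξ.2 + christoffel h x ξ.1 y) (η.2 + christoffel h x η.1 y)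
        + h x (fderiv ℝ (christoffel h) x ζ.1 ξ.1 y + christoffel h x ξ.1 ζ.2)
          (η.2 + christoffel h x η.1 y)
        + h x (ξ.2 + christoffel h x ξ.1 y)
          (fderiv ℝ (christoffel h) x ζ.1 η.1 y + christoffel h x η.1 ζ.2)) := by
  have hG := hh.isMetricOn_localGNatural ha hα
  have hd := (hG.differentiableAt (x := (x, y)) ⟨hx, trivial⟩).hasFDerivAt
  have h0 : HasFDerivAt (fun z => localGNatural h a b c z ξ η) _ (x, y) :=
    (hd.clm_apply (hasFDerivAt_const ξ _)).clm_apply (hasFDerivAt_const η _)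
  have hfst : HasFDerivAt (Prod.fst : E × E → E) (ContinuousLinearMap.fst ℝ E E) (x, y) :=
    hasFDerivAt_fst
  have hsnd : HasFDerivAt (Prod.snd : E × E → E) (ContinuousLinearMap.snd ℝ E E) (x, y) :=
    hasFDerivAt_snd
  have h1 : HasFDerivAt (fun z : E × E => h z.1) _ (x, y) :=
    (hh.differentiableAt hx).hasFDerivAt.comp (x, y) hfst
  have h2 : HasFDerivAt (fun z : E × E => christoffel h z.1) _ (x, y) :=
    HasFDerivAt.comp (g := christoffel h) (x, y)
      (hh.differentiableAt_christoffel hx).hasFDerivAt hfst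
  have hK (ζ : E × E) : HasFDerivAt (fun z : E × E => ζ.2 + christoffel h z.1 ζ.1 z.2) _ (x, y) :=
    ((h2.clm_apply (hasFDerivAt_const ζ.1 _)).clm_apply hsnd).const_add ζ.2
  have h3 := ((((h1.clm_apply (hasFDerivAt_const ξ.1 _)).clm_apply
      (hasFDerivAt_const η.1 _)).const_mul (a + c)).add
    ((((h1.clm_apply (hasFDerivAt_const ξ.1 _)).clm_apply (hK η)).add
      ((h1.clm_apply (hK ξ)).clm_apply (hasFDerivAt_const η.1 _))).const_mul b)).add
    (((h1.clm_apply (hK ξ)).clm_apply (hK η)).const_mul a)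
  have := congrArg (fun L => L ζ) (h0.unique h3)
  simp only [add_apply, ContinuousLinearMap.comp_apply, ContinuousLinearMap.flip_apply,
    smul_apply, zero_apply, map_zero, zero_add, smul_eq_mul, ContinuousLinearMap.coe_fst',
    ContinuousLinearMap.coe_snd'] at this
  rw [this]
  simp only [map_add, add_apply]
  ring

theorem christoffel_localGNatural_vertical (hh : IsMetricOn h U) (ha : 0 < a)
    (hα : 0 < a * (a + c) - b ^ 2) (hx : x ∈ U) (y t : E) (ξ : E × E) :
    christoffel (localGNatural h a b c) (x, y) (0, t) ξ = ((0 : E), christoffel h x ξ.1 t)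
      - (a ^ 2 / (2 * (a * (a + c) - b ^ 2))) •
        perpLift h a b x y (curvatureDual h x t y ξ.1) := by
  refine (hh.isMetricOn_localGNatural ha hα).christoffel_eq ⟨hx, trivial⟩ fun η => ?_
  obtain ⟨X, V⟩ := ξ
  obtain ⟨P, Q⟩ := η
  have hR := hh.apply_curvatureDual hx t y X P
  rw [hh.localCurvature_eq hx] at hR
  simp only [map_add, map_sub, add_apply, sub_apply] at hR
  have hperp : localGNatural h a b c (x, y)
      (perpLift h a b x y (curvatureDual h x t y X)) (P, Q) =
      (a * (a + c) - b ^ 2) / a * h x (curvatureDual h x t y X) P := by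
    simp only [localGNatural_apply, perpLift_apply, sub_add_cancel, map_smul, map_add,
      smul_apply, smul_eq_mul]
    field_simp
    ring
  rw [map_sub, map_smul, sub_apply, smul_apply, hperp, smul_eq_mul]
  have hcoef : a ^ 2 / (2 * (a * (a + c) - b ^ 2)) *
      ((a * (a + c) - b ^ 2) / a * h x (curvatureDual h x t y X) P) =
      a / 2 * h x (curvatureDual h x t y X) P := by
    have := hα.ne'
    field_simp
  rw [hcoef, hR, christoffelFirst_apply, hh.fderiv_localGNatural ha hα hx,
    hh.fderiv_localGNatural ha hα hx, hh.fderiv_localGNatural ha hα hx]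
  simp only [localGNatural_apply, hh.fderiv_apply hx, map_add, map_zero, add_apply, zero_apply,
    add_zero, zero_add, mul_zero]
  have hs := hh.symm x hx
  have hc := hh.christoffel_symm hx
  simp only [hs t]
  rw [hs X, hs V, hs (christoffel h x X y) (christoffel h x P t), hc P X]
  ring

/-- The curvature `R(ξ, wᵛ)tᵛ` of the metric `a gˢ + b gʰ + c gᵛ`. -/
theorem localCurvature_localGNatural_vertical (hh : IsMetricOn h U) (ha : 0 < a)
    (hα : 0 < a * (a + c) - b ^ 2) (hx : x ∈ U) {lam : ℝ}
    (hlam : lam = a ^ 2 / (2 * (a * (a + c) - b ^ 2))) (y w t : E) (ξ : E × E) :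
    localCurvature (localGNatural h a b c) (x, y) ξ (0, w) (0, t) =
      perpLift h a b x y (lam • curvatureDual h x t w ξ.1
        - lam ^ 2 • curvatureDual h x w y (curvatureDual h x t y ξ.1)) := by
  have hG := hh.isMetricOn_localGNatural ha hα
  have hmem : ((x, y) : E × E) ∈ U ×ˢ (Set.univ : Set E) := ⟨hx, trivial⟩
  have hvert (z : E × E) (hz : z ∈ U ×ˢ (Set.univ : Set E)) (w t : E) :
      christoffel (localGNatural h a b c) z (0, w) (0, t) = 0 := by
    obtain ⟨x', y'⟩ := z
    rw [hh.christoffel_localGNatural_vertical ha hα hz.1, hh.curvatureDual_zero hz.1]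
    simp
  have h1 : fderiv ℝ (fun z => christoffel (localGNatural h a b c) z (0, w) (0, t)) (x, y) ξ
      = 0 := by
    have : (fun z => christoffel (localGNatural h a b c) z (0, w) (0, t)) =ᶠ[nhds (x, y)]
        fun _ => (0 : E × E) := by
      filter_upwards [hG.isOpen.mem_nhds hmem] with z hz using hvert z hz w t
    rw [this.fderiv_eq]
    simp
  have hd : DifferentiableAt ℝ (fun z => christoffel (localGNatural h a b c) z ξ (0, t))
      (x, y) :=
    ((hG.differentiableAt_christoffel hmem).clm_apply (differentiableAt_const ξ)).clm_apply
      (differentiableAt_const _)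
  have hform (y' : E) : christoffel (localGNatural h a b c) (x, y') ξ (0, t) =
      ((0 : E), christoffel h x ξ.1 t) - lam • perpLift h a b x y' (curvatureDual h x t y' ξ.1) := by
    rw [hG.christoffel_symm ⟨hx, trivial⟩, hh.christoffel_localGNatural_vertical ha hα hx, hlam]
  have h2 : fderiv ℝ (fun z => christoffel (localGNatural h a b c) z ξ (0, t)) (x, y) (0, w) =
      -lam • (perpLift h a b x y (curvatureDual h x t w ξ.1)
        - ((0 : E), christoffel h x (curvatureDual h x t y ξ.1) w)) := by
    refine fderiv_apply_eq_of_cubic hd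
      (A₀ := ((0 : E), christoffel h x ξ.1 t)
        - lam • perpLift h a b x y (curvatureDual h x t y ξ.1))
      (A₂ := lam • ((0 : E), christoffel h x (curvatureDual h x t w ξ.1) w)) (A₃ := 0) fun s => ?_
    have hz : ((x, y) : E × E) + s • ((0 : E), w) = (x, y + s • w) := by simp
    rw [hz, hform, hh.curvatureDual_add_smul hx, perpLift_add_smul]
    simp only [map_add, map_smul, add_apply, smul_apply]
    ext
    · simp only [Prod.fst_add, Prod.fst_sub, Prod.smul_fst, Prod.fst_zero]
      module
    · simp only [Prod.snd_add, Prod.snd_sub, Prod.smul_snd, Prod.snd_zero]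
      module
  rw [localCurvature, h1, h2, hvert _ hmem, hform,
    hh.christoffel_localGNatural_vertical ha hα hx, ← hlam]
  have hfst : (((0 : E), christoffel h x ξ.1 t)
      - lam • perpLift h a b x y (curvatureDual h x t y ξ.1)).1 =
      -lam • curvatureDual h x t y ξ.1 := by
    simp [perpLift_apply]
  rw [hfst, hh.curvatureDual_smul hx]
  simp only [map_sub, map_smul, smul_apply, map_zero]
  ext
  · simp only [Prod.fst_add, Prod.fst_sub, Prod.smul_fst, Prod.fst_zero]
    module
  · simp only [Prod.snd_add, Prod.snd_sub, Prod.smul_snd, Prod.snd_zero]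
    module

theorem localCovDerivCurvature_localGNatural_vertical (hh : IsMetricOn h U) (ha : 0 < a)
    (hα : 0 < a * (a + c) - b ^ 2) (hx : x ∈ U) {lam : ℝ}
    (hlam : lam = a ^ 2 / (2 * (a * (a + c) - b ^ 2))) (y w : E) (ξ : E × E) :
    (localCovDerivCurvature (localGNatural h a b c) (x, y) (0, w) ξ (0, w) (0, y)).1 =
      lam ^ 2 • curvatureDual h x w y (curvatureDual h x w y ξ.1) := by
  have hG := hh.isMetricOn_localGNatural ha hα
  have hmem : ((x, y) : E × E) ∈ U ×ˢ (Set.univ : Set E) := ⟨hx, trivial⟩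
  have hR := fun (y w t : E) (ξ : E × E) =>
    hh.localCurvature_localGNatural_vertical ha hα hx hlam y w t ξ
  have hskew : ∀ X, curvatureDual h x y w X = -curvatureDual h x w y X :=
    hh.curvatureDual_swap hx y w
  have hself := hh.curvatureDual_self hx
  have hvert (t : E) : christoffel (localGNatural h a b c) (x, y) (0, w) (0, t) = 0 := by
    rw [hh.christoffel_localGNatural_vertical ha hα hx, hh.curvatureDual_zero hx]
    simp
  have h1 : fderiv ℝ (fun z => localCurvature (localGNatural h a b c) z ξ (0, w) (0, y)) (x, y)
      (0, w) = -lam ^ 2 • perpLift h a b x y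
        (curvatureDual h x w y (curvatureDual h x y w ξ.1))
        - ((0 : E), christoffel h x (lam • curvatureDual h x y w ξ.1) w) := by
    refine fderiv_apply_eq_of_cubic (hG.differentiableAt_localCurvature hmem _ _ _)
      (A₀ := lam • perpLift h a b x y (curvatureDual h x y w ξ.1))
      (A₂ := lam ^ 2 •
        ((0 : E), christoffel h x (curvatureDual h x w y (curvatureDual h x y w ξ.1)) w))
      (A₃ := 0) fun s => ?_
    have hz : ((x, y) : E × E) + s • ((0 : E), w) = (x, y + s • w) := by simp
    rw [hz, hR, perpLift_add_smul]
    simp only [hh.curvatureDual_add_smul hx, hself, zero_add, hh.curvatureDual_smul hx, smul_zero,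
      add_zero]
    simp only [map_sub, map_smul, sub_apply, smul_apply]
    ext
    · simp only [Prod.fst_add, Prod.fst_sub, Prod.smul_fst]
      module
    · simp only [Prod.snd_add, Prod.snd_sub, Prod.smul_snd]
      module
  have hRzero : localCurvature (localGNatural h a b c) (x, y) ξ 0 (0, y) = 0 := by
    rw [hG.localCurvature_eq hmem]
    simp
  have hRzero' : localCurvature (localGNatural h a b c) (x, y) ξ (0, w) 0 = 0 := by
    rw [hG.localCurvature_eq hmem]
    simp
  rw [localCovDerivCurvature, h1, hvert, hvert, hRzero, hRzero', hR, hR]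
  rw [hh.christoffel_localGNatural_vertical ha hα hx, hh.christoffel_localGNatural_vertical ha hα hx,
    ← hlam]
  simp only [hself, hh.curvatureDual_zero hx, smul_zero, sub_zero, perpLift_apply, Prod.fst_add,
    Prod.fst_sub, Prod.smul_fst, zero_sub, hh.curvatureDual_smul hx, hskew, ← neg_smul, smul_neg]
  rw [← neg_one_smul ℝ (curvatureDual h x w y ξ.1)]
  simp only [hh.curvatureDual_smul hx, smul_smul]
  module

end IsMetricOn

end LocalLift

section ChangeOfCoordinates

variable {E : Type*} [NormedAddCommGroup E] [NormedSpace ℝ E] [FiniteDimensional ℝ E]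
  {h₀ h₁ : E → E →L[ℝ] E →L[ℝ] ℝ} {U₀ U₁ : Set E}

/-- The transformation law of the Christoffel symbols under a change of coordinates `τ`. -/
theorem IsMetricOn.fderiv_apply_christoffel (hh₀ : IsMetricOn h₀ U₀) (hh₁ : IsMetricOn h₁ U₁)
    {τ : E → E} {x : E} (hx₀ : x ∈ U₀) (hx₁ : τ x ∈ U₁) (hτ : ContDiffAt ℝ 2 τ x)
    (hiso : ∀ᶠ z in nhds x, ∀ u v, h₀ z u v = h₁ (τ z) (fderiv ℝ τ z u) (fderiv ℝ τ z v))
    (hsurj : Function.Surjective (fderiv ℝ τ x)) (u v : E) :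
    fderiv ℝ τ x (christoffel h₀ x u v) =
      christoffel h₁ (τ x) (fderiv ℝ τ x u) (fderiv ℝ τ x v)
        + fderiv ℝ (fderiv ℝ τ) x u v := by
  have hD : ∀ s u v : E, fderiv ℝ h₀ x s u v =
      fderiv ℝ h₁ (τ x) (fderiv ℝ τ x s) (fderiv ℝ τ x u) (fderiv ℝ τ x v)
        + h₁ (τ x) (fderiv ℝ (fderiv ℝ τ) x s u) (fderiv ℝ τ x v)
        + h₁ (τ x) (fderiv ℝ τ x u) (fderiv ℝ (fderiv ℝ τ) x s v) := by
    intro s u v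
    have hd₀ := (hh₀.differentiableAt hx₀).hasFDerivAt
    have hd₁ := (hh₁.differentiableAt hx₁).hasFDerivAt
    have ht := (hτ.differentiableAt (by simp)).hasFDerivAt
    have ht' := ((hτ.fderiv_right (m := 1) (by norm_num)).differentiableAt (by simp)).hasFDerivAt
    have hl : HasFDerivAt (fun z => h₀ z u v) _ x :=
      (hd₀.clm_apply (hasFDerivAt_const u x)).clm_apply (hasFDerivAt_const v x)
    have hc : HasFDerivAt (fun z => h₁ (τ z)) _ x := hd₁.comp x ht
    have hr := (hc.clm_apply (ht'.clm_apply (hasFDerivAt_const u x))).clm_apply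
      (ht'.clm_apply (hasFDerivAt_const v x))
    have := congrArg (fun L => L s)
      (hl.unique (hr.congr_of_eventuallyEq (hiso.mono fun z hz => hz u v)))
    simp only [add_apply, ContinuousLinearMap.comp_apply, ContinuousLinearMap.flip_apply,
      zero_apply, map_zero, zero_add] at this
    rw [this]
    ring
  have hsymm (u v : E) : fderiv ℝ (fderiv ℝ τ) x u v = fderiv ℝ (fderiv ℝ τ) x v u :=
    (hτ.isSymmSndFDerivAt (by simp)).eq u v
  refine hh₁.eq_of_forall hx₁ fun w' => ?_
  obtain ⟨w, rfl⟩ := hsurj w'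
  rw [← hiso.self_of_nhds, hh₀.apply_christoffel hx₀, map_add, add_apply,
    hh₁.apply_christoffel hx₁, christoffelFirst_apply, christoffelFirst_apply, hD, hD, hD,
    hsymm v u, hsymm w u, hsymm w v,
    hh₁.symm _ hx₁ (fderiv ℝ τ x v) (fderiv ℝ (fderiv ℝ τ) x u w)]
  ring

end ChangeOfCoordinates

section Charts

variable {E : Type*} [NormedAddCommGroup E] [NormedSpace ℝ E]
  {H : Type*} [TopologicalSpace H] (I : ModelWithCorners ℝ E H)
  {N : Type*} [TopologicalSpace N] [ChartedSpace H N]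

/-- The change of coordinates from the preferred chart at `p` to the preferred chart at `q`. -/
noncomputable def chartTransition (p q : N) : E → E := extChartAt I q ∘ (extChartAt I p).symm

/-- A field of bilinear forms on the tangent spaces, as a function to the bilinear forms on the
model space. -/
def toModel (g : ∀ q : N, TangentSpace I q →L[ℝ] TangentSpace I q →L[ℝ] ℝ) (q : N) :
    E →L[ℝ] E →L[ℝ] ℝ :=
  g q

theorem extChartAt_symm_chartTransition {p q : N} {z : E}
    (hq : (extChartAt I p).symm z ∈ (extChartAt I q).source) :
    (extChartAt I q).symm (chartTransition I p q z) = (extChartAt I p).symm z :=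
  (extChartAt I q).left_inv hq

theorem chartTransition_mem_target {p q : N} {z : E}
    (hq : (extChartAt I p).symm z ∈ (extChartAt I q).source) :
    chartTransition I p q z ∈ (extChartAt I q).target :=
  (extChartAt I q).map_source hq

theorem toModel_symm [IsManifold I 1 N]
    (g : Bundle.ContMDiffRiemannianMetric I ∞ E (fun x : N => TangentSpace I x)) (q : N) (u v : E) :
    toModel I g.inner q u v = toModel I g.inner q v u :=
  g.symm q u v

theorem toModel_pos [IsManifold I 1 N]
    (g : Bundle.ContMDiffRiemannianMetric I ∞ E (fun x : N => TangentSpace I x)) (q : N) (u : E)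
    (hu : u ≠ 0) : 0 < toModel I g.inner q u u :=
  g.pos q u hu

variable [I.Boundaryless]

theorem mdifferentiableAt_extChartAt_symm [IsManifold I 1 N] {p : N} {z : E}
    (hz : z ∈ (extChartAt I p).target) :
    MDifferentiableAt 𝓘(ℝ, E) I (extChartAt I p).symm z := by
  have := mdifferentiableWithinAt_extChartAt_symm (I := I) hz
  rwa [I.range_eq_univ, mdifferentiableWithinAt_univ] at this

theorem mfderiv_extChartAt_symm [IsManifold I 1 N] {p : N} {z : E}
    (hz : z ∈ (extChartAt I p).target) :
    mfderiv 𝓘(ℝ, E) I (extChartAt I p).symm z =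
      (fderiv ℝ (chartTransition I p ((extChartAt I p).symm z)) z : E →L[ℝ] E) := by
  rw [(mdifferentiableAt_extChartAt_symm I hz).mfderiv]
  simp only [writtenInExtChartAt, chartTransition, extChartAt_model_space_eq_id,
    PartialEquiv.refl_symm, PartialEquiv.refl_coe, Function.comp_id, modelWithCornersSelf_coe,
    Set.range_id, fderivWithin_univ, id_eq]
  rfl

theorem inChart_eq [IsManifold I 1 N]
    (g : ∀ q : N, TangentSpace I q →L[ℝ] TangentSpace I q →L[ℝ] ℝ) {p : N} {z : E}
    (hz : z ∈ (extChartAt I p).target) (u v : E) :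
    inChart I g p z u v = toModel I g ((extChartAt I p).symm z)
      (fderiv ℝ (chartTransition I p ((extChartAt I p).symm z)) z u)
      (fderiv ℝ (chartTransition I p ((extChartAt I p).symm z)) z v) := by
  rw [← mfderiv_extChartAt_symm I hz]
  rfl

theorem contDiffAt_chartTransition [IsManifold I ∞ N] {p q : N} {z : E}
    (hz : z ∈ (extChartAt I p).target)
    (hq : (extChartAt I p).symm z ∈ (extChartAt I q).source) :
    ContDiffAt ℝ ∞ (chartTransition I p q) z := by
  have := contDiffWithinAt_ext_coord_change (I := I) (n := ∞) q p (y := z) (by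
    rw [PartialEquiv.trans_source]; exact ⟨hz, hq⟩)
  rwa [I.range_eq_univ, contDiffWithinAt_univ] at this

theorem eventually_mem_source_of_mem {p q : N} {z : E}
    (hz : z ∈ (extChartAt I p).target)
    (hq : (extChartAt I p).symm z ∈ (extChartAt I q).source) :
    ∀ᶠ z' in nhds z, z' ∈ (extChartAt I p).target ∧
      (extChartAt I p).symm z' ∈ (extChartAt I q).source :=
  Filter.Eventually.and ((isOpen_extChartAt_target p).mem_nhds hz)
    ((continuousAt_extChartAt_symm'' hz).preimage_mem_nhds
      ((isOpen_extChartAt_source q).mem_nhds hq))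

theorem fderiv_chartTransition_self {p : N} {z : E} (hz : z ∈ (extChartAt I p).target) :
    fderiv ℝ (chartTransition I p p) z = ContinuousLinearMap.id ℝ E := by
  have : chartTransition I p p =ᶠ[nhds z] id := by
    filter_upwards [(isOpen_extChartAt_target p).mem_nhds hz] with z' hz'
    exact (extChartAt I p).right_inv hz'
  rw [this.fderiv_eq, fderiv_id]

theorem fderiv_chartTransition_comp [IsManifold I ∞ N] {p q r : N} {z : E}
    (hz : z ∈ (extChartAt I p).target)
    (hq : (extChartAt I p).symm z ∈ (extChartAt I q).source)
    (hr : (extChartAt I p).symm z ∈ (extChartAt I r).source) (u : E) :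
    fderiv ℝ (chartTransition I q r) (chartTransition I p q z)
      (fderiv ℝ (chartTransition I p q) z u) = fderiv ℝ (chartTransition I p r) z u := by
  have heq : chartTransition I q r ∘ chartTransition I p q =ᶠ[nhds z] chartTransition I p r := by
    filter_upwards [eventually_mem_source_of_mem I hz hq] with z' hz'
    exact congrArg (extChartAt I r) (extChartAt_symm_chartTransition I hz'.2)
  have hr' : (extChartAt I q).symm (chartTransition I p q z) ∈ (extChartAt I r).source := by
    rwa [extChartAt_symm_chartTransition I hq]
  have := fderiv_comp z
    ((contDiffAt_chartTransition I (chartTransition_mem_target I hq) hr').differentiableAt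
      (by simp))
    ((contDiffAt_chartTransition I hz hq).differentiableAt (by simp))
  rw [heq.fderiv_eq] at this
  rw [this, ContinuousLinearMap.comp_apply]

theorem inChart_eq_inChart_chartTransition [IsManifold I ∞ N]
    (g : ∀ q : N, TangentSpace I q →L[ℝ] TangentSpace I q →L[ℝ] ℝ) {p q : N} {z : E}
    (hz : z ∈ (extChartAt I p).target)
    (hq : (extChartAt I p).symm z ∈ (extChartAt I q).source) (u v : E) :
    inChart I g p z u v = inChart I g q (chartTransition I p q z)
      (fderiv ℝ (chartTransition I p q) z u) (fderiv ℝ (chartTransition I p q) z v) := by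
  rw [inChart_eq I g hz, inChart_eq I g (chartTransition_mem_target I hq)]
  rw [extChartAt_symm_chartTransition I hq,
    fderiv_chartTransition_comp I hz hq (mem_extChartAt_source _),
    fderiv_chartTransition_comp I hz hq (mem_extChartAt_source _)]

theorem inChart_extChartAt_self [IsManifold I 1 N]
    (g : ∀ q : N, TangentSpace I q →L[ℝ] TangentSpace I q →L[ℝ] ℝ) (p : N) :
    inChart I g p (extChartAt I p p) = toModel I g p := by
  have hz := mem_extChartAt_target (I := I) p
  ext u v
  rw [inChart_eq I g hz, extChartAt_to_inv, fderiv_chartTransition_self I hz]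
  rfl

theorem fderiv_chartTransition_bijective [IsManifold I ∞ N] {p q : N} {z : E}
    (hz : z ∈ (extChartAt I p).target)
    (hq : (extChartAt I p).symm z ∈ (extChartAt I q).source) :
    Function.Bijective (fderiv ℝ (chartTransition I p q) z) := by
  have key : ∀ {p q : N} {z : E}, z ∈ (extChartAt I p).target →
      (extChartAt I p).symm z ∈ (extChartAt I q).source →
      Function.LeftInverse (fderiv ℝ (chartTransition I q p) (chartTransition I p q z))
        (fderiv ℝ (chartTransition I p q) z) := fun {p q z} hz hq u => by
    rw [fderiv_chartTransition_comp I hz hq ((extChartAt I p).map_target hz),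
      fderiv_chartTransition_self I hz, ContinuousLinearMap.id_apply]
  have hback : chartTransition I q p (chartTransition I p q z) = z := by
    change extChartAt I p ((extChartAt I q).symm (chartTransition I p q z)) = z
    rw [extChartAt_symm_chartTransition I hq, (extChartAt I p).right_inv hz]
  have h2 := key (chartTransition_mem_target I hq) (q := p) (by
    rw [extChartAt_symm_chartTransition I hq]; exact (extChartAt I p).map_target hz)
  rw [hback] at h2
  exact ⟨(key hz hq).injective, h2.surjective⟩

theorem contDiffOn_inChart [FiniteDimensional ℝ E] [IsManifold I ∞ N]
    (g : Bundle.ContMDiffRiemannianMetric I ∞ E (fun x : N => TangentSpace I x)) (p : N) :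
    ContDiffOn ℝ ∞ (inChart I g.inner p) (extChartAt I p).target := by
  have hopen := isOpen_extChartAt_target (I := I) p
  have hsymm : ContMDiffOn 𝓘(ℝ, E) I ∞ (extChartAt I p).symm (extChartAt I p).target :=
    contMDiffOn_extChartAt_symm p
  have hvec (u : E) : ContMDiffOn 𝓘(ℝ, E) I.tangent ∞
      (fun z => Bundle.TotalSpace.mk' E (E := fun x : N => TangentSpace I x)
        ((extChartAt I p).symm z) (mfderiv 𝓘(ℝ, E) I (extChartAt I p).symm z u))
      (extChartAt I p).target := by
    have h1 := hsymm.contMDiffOn_tangentMapWithin (m := ∞) (by simp) hopen.uniqueMDiffOn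
    have h2 : ContMDiff 𝓘(ℝ, E) 𝓘(ℝ, E).tangent ∞
        (fun z : E => (⟨z, u⟩ : TangentBundle 𝓘(ℝ, E) E)) :=
      contMDiff_vectorSpace_iff_contDiff.2 contDiff_const
    refine (h1.comp h2.contMDiffOn fun z hz => hz).congr fun z hz => ?_
    simp only [Function.comp_apply, tangentMapWithin, mfderivWithin_of_isOpen hopen hz]
  rw [contDiffOn_clm_apply]
  intro u
  rw [contDiffOn_clm_apply]
  intro v
  rw [← contMDiffOn_iff_contDiffOn]
  have hg := (g.contMDiff.comp_contMDiffOn hsymm)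
  have := ContMDiffOn.clm_bundle_apply₂ (F₁ := E) (F₂ := E) (F₃ := ℝ)
    (E₁ := fun x : N => TangentSpace I x) (E₂ := fun x : N => TangentSpace I x)
    (E₃ := Bundle.Trivial N ℝ) hg (hvec u) (hvec v)
  intro z hz
  exact ((Bundle.contMDiffWithinAt_totalSpace.1 (this z hz)).2)

theorem isMetricOn_inChart [FiniteDimensional ℝ E] [IsManifold I ∞ N]
    (g : Bundle.ContMDiffRiemannianMetric I ∞ E (fun x : N => TangentSpace I x)) (p : N) :
    IsMetricOn (inChart I g.inner p) (extChartAt I p).target where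
  isOpen := isOpen_extChartAt_target p
  contDiffOn := contDiffOn_inChart I g p
  symm z hz u v := by
    rw [inChart_eq I g.inner hz, inChart_eq I g.inner hz, toModel_symm]
  pos z hz u hu := by
    rw [inChart_eq I g.inner hz]
    refine toModel_pos I g _ _ fun h0 => hu ?_
    exact (fderiv_chartTransition_bijective I hz (mem_extChartAt_source _)).injective
      (h0.trans (map_zero _).symm)

end Charts

section TangentBundleCharts

variable {E : Type*} [NormedAddCommGroup E] [NormedSpace ℝ E]
  {H : Type*} [TopologicalSpace H] (I : ModelWithCorners ℝ E H)
  {M : Type*} [TopologicalSpace M] [ChartedSpace H M]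

theorem extChartAt_tangent_target [IsManifold I 1 M] (p : TangentBundle I M) :
    (extChartAt I.tangent p).target = (extChartAt I p.proj).target ×ˢ (Set.univ : Set E) := by
  rw [FiberBundle.extChartAt_target]
  ext z
  simp only [Set.mem_inter_iff, Set.mem_prod, Set.mem_univ, and_true, Set.mem_preimage]
  constructor
  · exact fun h => h.1
  · intro h
    refine ⟨h, ?_⟩
    have := (extChartAt I p.proj).map_target h
    rwa [extChartAt_source] at this

theorem toModel_gNatural_apply [IsManifold I 1 M]
    (g : ∀ x : M, TangentSpace I x →L[ℝ] TangentSpace I x →L[ℝ] ℝ) (a b c : ℝ)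
    (q : TangentBundle I M) (ξ η : E × E) :
    toModel I.tangent (gNatural I g a b c) q ξ η = (a + c) * toModel I g q.proj ξ.1 η.1
      + b * (toModel I g q.proj ξ.1 (η.2 + christoffelAt I g q.proj η.1 q.snd)
        + toModel I g q.proj (ξ.2 + christoffelAt I g q.proj ξ.1 q.snd) η.1)
      + a * toModel I g q.proj (ξ.2 + christoffelAt I g q.proj ξ.1 q.snd)
        (η.2 + christoffelAt I g q.proj η.1 q.snd) :=
  gNatural_apply I g a b c q ξ η

variable [I.Boundaryless]

theorem tangentCoordChange_eq_fderiv [IsManifold I 1 M] (x x' y : M) :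
    tangentCoordChange I x x' y = fderiv ℝ (chartTransition I x x') (extChartAt I x y) := by
  rw [tangentCoordChange_def, I.range_eq_univ, fderivWithin_univ]
  rfl

theorem extChartAt_tangent_apply [IsManifold I 1 M] (p q : TangentBundle I M) :
    extChartAt I.tangent p q = (extChartAt I p.proj q.proj,
      fderiv ℝ (chartTransition I q.proj p.proj) (extChartAt I q.proj q.proj) q.snd) := by
  rw [← tangentCoordChange_eq_fderiv]
  rfl

theorem extChartAt_tangent_symm_apply [IsManifold I 1 M] (p : TangentBundle I M) {z : E × E}
    (hz : z.1 ∈ (extChartAt I p.proj).target) :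
    (extChartAt I.tangent p).symm z = ⟨(extChartAt I p.proj).symm z.1,
      fderiv ℝ (chartTransition I p.proj ((extChartAt I p.proj).symm z.1)) z.1 z.2⟩ := by
  have h1 : (extChartAt I.tangent p).symm z = ⟨(extChartAt I p.proj).symm z.1,
      tangentCoordChange I p.proj ((extChartAt I p.proj).symm z.1)
        ((extChartAt I p.proj).symm z.1) z.2⟩ := rfl
  rw [h1, tangentCoordChange_eq_fderiv, (extChartAt I p.proj).right_inv hz]

theorem chartTransition_tangent_apply [IsManifold I ∞ M] (p q : TangentBundle I M) {z : E × E}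
    (hz : z.1 ∈ (extChartAt I p.proj).target)
    (hq : (extChartAt I p.proj).symm z.1 ∈ (extChartAt I q.proj).source) :
    chartTransition I.tangent p q z = (chartTransition I p.proj q.proj z.1,
      fderiv ℝ (chartTransition I p.proj q.proj) z.1 z.2) := by
  rw [chartTransition, Function.comp_apply, extChartAt_tangent_symm_apply I p hz,
    extChartAt_tangent_apply]
  refine Prod.ext rfl ?_
  exact fderiv_chartTransition_comp I hz (mem_extChartAt_source _) hq z.2

theorem fderiv_chartTransition_tangent [IsManifold I ∞ M] (p q : TangentBundle I M) {z : E × E}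
    (hz : z.1 ∈ (extChartAt I p.proj).target)
    (hq : (extChartAt I p.proj).symm z.1 ∈ (extChartAt I q.proj).source) (ξ : E × E) :
    fderiv ℝ (chartTransition I.tangent p q) z ξ =
      (fderiv ℝ (chartTransition I p.proj q.proj) z.1 ξ.1,
        fderiv ℝ (fderiv ℝ (chartTransition I p.proj q.proj)) z.1 ξ.1 z.2
          + fderiv ℝ (chartTransition I p.proj q.proj) z.1 ξ.2) := by
  set τ := chartTransition I p.proj q.proj
  have hτ := contDiffAt_chartTransition I hz hq
  have heq : chartTransition I.tangent p q =ᶠ[nhds z] fun z => (τ z.1, fderiv ℝ τ z.1 z.2) := by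
    have := (continuous_fst (X := E) (Y := E)).continuousAt.eventually
      (eventually_mem_source_of_mem I hz hq)
    filter_upwards [this] with z' hz'
    exact chartTransition_tangent_apply I p q hz'.1 hz'.2
  have hfst : HasFDerivAt (Prod.fst : E × E → E) (ContinuousLinearMap.fst ℝ E E) z :=
    hasFDerivAt_fst
  have hsnd : HasFDerivAt (Prod.snd : E × E → E) (ContinuousLinearMap.snd ℝ E E) z :=
    hasFDerivAt_snd
  have h1 : HasFDerivAt (fun z : E × E => τ z.1) _ z :=
    (hτ.differentiableAt (by simp)).hasFDerivAt.comp z hfst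
  have h2 : HasFDerivAt (fun z : E × E => fderiv ℝ τ z.1) _ z :=
    HasFDerivAt.comp (g := fderiv ℝ τ) z
      ((hτ.fderiv_right (m := 1) (by norm_cast)).differentiableAt (by simp)).hasFDerivAt hfst
  rw [heq.fderiv_eq, (h1.prodMk (h2.clm_apply hsnd)).fderiv]
  simp only [ContinuousLinearMap.prod_apply, add_apply, ContinuousLinearMap.comp_apply,
    ContinuousLinearMap.flip_apply, ContinuousLinearMap.coe_fst', ContinuousLinearMap.coe_snd']
  rw [add_comm]

/-- The transformation law of the Christoffel symbols from the chart at `x₀` to the preferred chart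
at the point with coordinates `z`. -/
theorem fderiv_chartTransition_christoffel [FiniteDimensional ℝ E] [IsManifold I ∞ M]
    (g : Bundle.ContMDiffRiemannianMetric I ∞ E (fun x : M => TangentSpace I x))
    {x₀ : M} {z : E} (hz : z ∈ (extChartAt I x₀).target) (u v : E) :
    fderiv ℝ (chartTransition I x₀ ((extChartAt I x₀).symm z)) z
        (christoffel (inChart I g.inner x₀) z u v) =
      christoffelAt I g.inner ((extChartAt I x₀).symm z)
          (fderiv ℝ (chartTransition I x₀ ((extChartAt I x₀).symm z)) z u)
          (fderiv ℝ (chartTransition I x₀ ((extChartAt I x₀).symm z)) z v)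
        + fderiv ℝ (fderiv ℝ (chartTransition I x₀ ((extChartAt I x₀).symm z))) z u v := by
  have hsrc : (extChartAt I x₀).symm z ∈ (extChartAt I ((extChartAt I x₀).symm z)).source :=
    mem_extChartAt_source _
  exact (isMetricOn_inChart I g x₀).fderiv_apply_christoffel (isMetricOn_inChart I g _) hz
    (chartTransition_mem_target I hsrc)
    ((contDiffAt_chartTransition I hz hsrc).of_le (by norm_cast))
    ((eventually_mem_source_of_mem I hz hsrc).mono fun z' hz' u v =>
      inChart_eq_inChart_chartTransition I g.inner hz'.1 hz'.2 u v)
    (fderiv_chartTransition_bijective I hz hsrc).surjective u v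

theorem inChart_gNatural_apply [FiniteDimensional ℝ E] [IsManifold I ∞ M]
    (g : Bundle.ContMDiffRiemannianMetric I ∞ E (fun x : M => TangentSpace I x)) (a b c : ℝ)
    (p : TangentBundle I M) {z : E × E} (hz : z.1 ∈ (extChartAt I p.proj).target) (ξ η : E × E) :
    inChart I.tangent (gNatural I g.inner a b c) p z ξ η =
      localGNatural (inChart I g.inner p.proj) a b c z ξ η := by
  have hz' : z ∈ (extChartAt I.tangent p).target := by
    rw [extChartAt_tangent_target]; exact ⟨hz, trivial⟩
  have hΓ := fun u => fderiv_chartTransition_christoffel I g hz u z.2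
  rw [inChart_eq I.tangent _ hz', extChartAt_tangent_symm_apply I p hz,
    fderiv_chartTransition_tangent I p _ hz (mem_extChartAt_source _),
    fderiv_chartTransition_tangent I p _ hz (mem_extChartAt_source _),
    toModel_gNatural_apply, localGNatural_apply]
  simp only [inChart_eq I g.inner hz, map_add, hΓ, add_apply]
  ring

/-- The expression of the metric `a gˢ + b gʰ + c gᵛ` in the coordinates of `TM` induced by
coordinates of `M`. -/
theorem inChart_gNatural [FiniteDimensional ℝ E] [IsManifold I ∞ M]
    (g : Bundle.ContMDiffRiemannianMetric I ∞ E (fun x : M => TangentSpace I x)) (a b c : ℝ)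
    (p : TangentBundle I M) {z : E × E} (hz : z.1 ∈ (extChartAt I p.proj).target) :
    inChart I.tangent (gNatural I g.inner a b c) p z =
      localGNatural (inChart I g.inner p.proj) a b c z :=
  ContinuousLinearMap.ext fun ξ => ContinuousLinearMap.ext fun η =>
    inChart_gNatural_apply I g a b c p hz ξ η

theorem extChartAt_tangent_self [IsManifold I 1 M] (p : TangentBundle I M) :
    extChartAt I.tangent p p = (extChartAt I p.proj p.proj, p.snd) := by
  rw [extChartAt_tangent_apply, fderiv_chartTransition_self I (mem_extChartAt_target _)]
  rfl

end TangentBundleCharts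

section Congruence

variable {F : Type*} [NormedAddCommGroup F] [NormedSpace ℝ F]
  {h h' : F → F →L[ℝ] F →L[ℝ] ℝ} {z : F}

theorem christoffel_congr (hh : h =ᶠ[nhds z] h') : christoffel h =ᶠ[nhds z] christoffel h' := by
  filter_upwards [hh, hh.fderiv (𝕜 := ℝ)] with z' h1 h2
  simp only [christoffel, christoffelFirst, h1, h2]

theorem localCurvature_congr (hh : h =ᶠ[nhds z] h') (u v w : F) :
    (fun z' => localCurvature h z' u v w) =ᶠ[nhds z] fun z' => localCurvature h' z' u v w := by
  filter_upwards [(christoffel_congr hh).eventuallyEq_nhds] with z' h1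
  have h2 (u v : F) : (fun z'' => christoffel h z'' u v) =ᶠ[nhds z']
      fun z'' => christoffel h' z'' u v := by
    filter_upwards [h1] with z'' h3
    rw [h3]
  simp only [localCurvature, (h2 _ _).fderiv_eq, h1.eq_of_nhds]

theorem localCovDerivCurvature_congr (hh : h =ᶠ[nhds z] h') (s u v w : F) :
    localCovDerivCurvature h z s u v w = localCovDerivCurvature h' z s u v w := by
  have h1 (u v w : F) : localCurvature h z u v w = localCurvature h' z u v w :=
    (localCurvature_congr hh u v w).eq_of_nhds
  simp only [localCovDerivCurvature, (localCurvature_congr hh _ _ _).fderiv_eq, h1,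
    (christoffel_congr hh).eq_of_nhds]

end Congruence

section OneForm

variable {E : Type*} [NormedAddCommGroup E] [NormedSpace ℝ E]
  {H : Type*} [TopologicalSpace H] (I : ModelWithCorners ℝ E H)
  {M : Type*} [TopologicalSpace M] [ChartedSpace H M]

theorem continuousAt_oneForm_vlift [IsManifold I ∞ M]
    {θ : ∀ p : TangentBundle I M, TangentSpace I.tangent p →L[ℝ] ℝ}
    (hθ : IsSmoothOneForm I.tangent θ) (x : M) (y : E) :
    ContinuousAt (fun s : ℝ => θ (⟨x, (s • y : E)⟩ : TangentBundle I M) ((0, y) : E × E)) 0 := by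
  have h1 := ((contMDiffAt_hom_bundle _).1 (hθ (⟨x, ((0 : ℝ) • y : E)⟩ : TangentBundle I M))).2
  have hcurve : Continuous (fun s : ℝ => (⟨x, (s • y : E)⟩ : TangentBundle I M)) :=
    (FiberBundle.continuous_totalSpaceMk E (TangentSpace I : M → Type _) x).comp
      (show Continuous fun s : ℝ => (s • y : E) by fun_prop)
  have h2 := (h1.continuousAt.comp (f := fun s : ℝ => (⟨x, (s • y : E)⟩ : TangentBundle I M)) (x := 0)
    hcurve.continuousAt).clm_apply (continuousAt_const (y := ((0, y) : E × E)))
  refine h2.congr (Filter.Eventually.of_forall fun s => ?_)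
  have hmem : (⟨x, (s • y : E)⟩ : TangentBundle I M) ∈
      (chartAt (ModelProd H E) (⟨x, ((0 : ℝ) • y : E)⟩ : TangentBundle I M)).source := by
    rw [TangentBundle.mem_chart_source_iff]
    exact mem_chart_source H x
  have hsymmL : ((trivializationAt (E × E) (TangentSpace I.tangent)
      (⟨x, ((0 : ℝ) • y : E)⟩ : TangentBundle I M)).symmL ℝ
      (⟨x, (s • y : E)⟩ : TangentBundle I M) : E × E → E × E) (0, y) = (0, y) := by
    rw [TangentBundle.symmL_trivializationAt_eq_core hmem]
    exact tangentCoordChange_self (I := I.tangent) (x := (⟨x, (s • y : E)⟩ : TangentBundle I M))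
      (mem_extChartAt_source _)
  have htriv : (trivializationAt ℝ (Bundle.Trivial (TangentBundle I M) ℝ)
      (⟨x, ((0 : ℝ) • y : E)⟩ : TangentBundle I M)).continuousLinearMapAt ℝ
      (⟨x, (s • y : E)⟩ : TangentBundle I M) = ContinuousLinearMap.id ℝ ℝ :=
    Bundle.Trivial.continuousLinearMapAt_trivialization ℝ (TangentBundle I M) ℝ _
  exact (congrArg (fun L : ℝ →L[ℝ] ℝ => L _) htriv).trans
    (congrArg (θ (⟨x, (s • y : E)⟩ : TangentBundle I M)) hsymmL)

end OneForm

section WeaklySymmetric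

variable {E : Type*} [NormedAddCommGroup E] [NormedSpace ℝ E] [FiniteDimensional ℝ E]

/-- The pointwise algebraic consequence of weak symmetry of `a gˢ + b gʰ + c gᵛ`. -/
theorem IsMetricOn.one_add_mul_apply_curvatureDual {h : E → E →L[ℝ] E →L[ℝ] ℝ} {U : Set E} {x : E}
    (hh : IsMetricOn h U) (hx : x ∈ U) {a b c : ℝ} (ha : 0 < a) (hα : 0 < a * (a + c) - b ^ 2)
    (y : E) (θ₁ θ₂ : E × E →L[ℝ] ℝ) (σ : E × E)
    (heq : ∀ X Y Z W : E × E,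
      localCovDerivCurvature (localGNatural h a b c) (x, y) W X Y Z =
        θ₁ W • localCurvature (localGNatural h a b c) (x, y) X Y Z
        + θ₂ X • localCurvature (localGNatural h a b c) (x, y) W Y Z
        + θ₂ Y • localCurvature (localGNatural h a b c) (x, y) X W Z
        + θ₂ Z • localCurvature (localGNatural h a b c) (x, y) X Y W
        + localGNatural h a b c (x, y)
          (localCurvature (localGNatural h a b c) (x, y) X Y Z) W • σ) (w X : E) :
    (1 + θ₂ (0, y)) * h x (curvatureDual h x w y X) (curvatureDual h x w y X) = 0 := by
  obtain ⟨lam, hlam⟩ : ∃ lam, lam = a ^ 2 / (2 * (a * (a + c) - b ^ 2)) := ⟨_, rfl⟩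
  have hlam0 : lam ≠ 0 := by rw [hlam]; positivity
  have hR := fun (w t : E) (ξ : E × E) =>
    hh.localCurvature_localGNatural_vertical ha hα hx hlam y w t ξ
  have hperp (Z : E) : localGNatural h a b c (x, y) (perpLift h a b x y Z) (0, w) = 0 := by
    simp only [localGNatural_apply, perpLift_apply, sub_add_cancel, map_smul, map_zero,
      zero_apply, add_zero, smul_apply, smul_eq_mul, mul_zero]
    field_simp
    ring
  have h1 := congrArg Prod.fst (heq (X, 0) (0, w) (0, y) (0, w))
  rw [hh.localCovDerivCurvature_localGNatural_vertical ha hα hx hlam, hR, hR, hR, hperp] at h1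
  simp only [perpLift_apply, hh.curvatureDual_self hx, hh.curvatureDual_zero hx, smul_zero,
    sub_zero, zero_smul, add_zero, zero_sub, Prod.fst_add, Prod.smul_fst,
    hh.curvatureDual_swap hx y w] at h1
  have h2 := congrArg (fun Z => h x Z X) h1
  simp only [map_add, map_smul, map_neg, add_apply, smul_apply, neg_apply, smul_eq_mul,
    hh.apply_curvatureDual_self hx, hh.apply_curvatureDual_skew hx w y _ X] at h2
  have h3 : lam ^ 2 * ((1 + θ₂ (0, y)) *
      h x (curvatureDual h x w y X) (curvatureDual h x w y X)) = 0 := by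
    linear_combination -h2
  exact (mul_eq_zero.1 h3).resolve_left (pow_ne_zero 2 hlam0)

variable {H : Type*} [TopologicalSpace H] (I : ModelWithCorners ℝ E H)
    {M : Type*} [TopologicalSpace M] [ChartedSpace H M]

/-- The dichotomy at `p` that weak symmetry of `a gˢ + b gʰ + c gᵛ` imposes on the curvature. -/
theorem IsWeaklySymmetric.one_add_mul_apply_curvatureDual [I.Boundaryless] [IsManifold I ∞ M]
    (g : Bundle.ContMDiffRiemannianMetric I ∞ E (fun x : M => TangentSpace I x))
    {a b c : ℝ} (ha : 0 < a) (hα : 0 < a * (a + c) - b ^ 2)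
    {α₁ α₂ : ∀ p : TangentBundle I M, TangentSpace I.tangent p →L[ℝ] ℝ}
    (hws : IsWeaklySymmetric I.tangent (gNatural I g.inner a b c) α₁ α₂)
    (x : M) (y w X : E) :
    (1 + α₂ (⟨x, y⟩ : TangentBundle I M) ((0, y) : E × E)) *
      inChart I g.inner x (extChartAt I x x)
        (curvatureDual (inChart I g.inner x) (extChartAt I x x) w y X)
        (curvatureDual (inChart I g.inner x) (extChartAt I x x) w y X) = 0 := by
  set p : TangentBundle I M := ⟨x, y⟩ with hp
  have hself : extChartAt I.tangent p p = (extChartAt I x x, y) := extChartAt_tangent_self I p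
  have hcongr : inChart I.tangent (gNatural I g.inner a b c) p =ᶠ[nhds (extChartAt I x x, y)]
      localGNatural (inChart I g.inner x) a b c := by
    have hopen := (isOpen_extChartAt_target (I := I) x).prod (isOpen_univ (X := E))
    filter_upwards [hopen.mem_nhds ⟨mem_extChartAt_target x, trivial⟩] with z hz
    exact inChart_gNatural I g a b c p hz.1
  have hR (u v w : E × E) : curvature I.tangent (gNatural I g.inner a b c) p u v w =
      (localCurvature (localGNatural (inChart I g.inner x) a b c) (extChartAt I x x, y) u v w :
        E × E) := by
    unfold curvature
    rw [hself]
    exact (localCurvature_congr hcongr u v w).eq_of_nhds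
  have hDR (s u v w : E × E) : covDerivCurvature I.tangent (gNatural I g.inner a b c) p s u v w =
      (localCovDerivCurvature (localGNatural (inChart I g.inner x) a b c) (extChartAt I x x, y)
        s u v w : E × E) := by
    unfold covDerivCurvature
    rw [hself]
    exact localCovDerivCurvature_congr hcongr s u v w
  have hG : toModel I.tangent (gNatural I g.inner a b c) p =
      localGNatural (inChart I g.inner x) a b c (extChartAt I x x, y) := by
    rw [← inChart_extChartAt_self, hself]
    exact hcongr.eq_of_nhds
  refine (isMetricOn_inChart I g x).one_add_mul_apply_curvatureDual (mem_extChartAt_target x)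
    ha hα y (α₁ p) (α₂ p) (sharp I.tangent (gNatural I g.inner a b c) p (α₂ p))
    (fun X Y Z W => ?_) w X
  have h1 := hws.eqn p X Y Z W
  rw [hDR, hR, hR, hR, hR] at h1
  rw [← hG]
  exact h1

/-- If `a gˢ + b gʰ + c gᵛ` is weakly symmetric, then `g` is flat. -/
theorem IsWeaklySymmetric.localCurvature_eq_zero [I.Boundaryless] [IsManifold I ∞ M]
    (g : Bundle.ContMDiffRiemannianMetric I ∞ E (fun x : M => TangentSpace I x))
    {a b c : ℝ} (ha : 0 < a) (hα : 0 < a * (a + c) - b ^ 2)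
    {α₁ α₂ : ∀ p : TangentBundle I M, TangentSpace I.tangent p →L[ℝ] ℝ}
    (hws : IsWeaklySymmetric I.tangent (gNatural I g.inner a b c) α₁ α₂)
    (x : M) (X W y : E) :
    localCurvature (inChart I g.inner x) (extChartAt I x x) X W y = 0 := by
  have hh := isMetricOn_inChart I g x
  have hx := mem_extChartAt_target (I := I) x
  set z := extChartAt I x x
  set h := inChart I g.inner x
  have hdual (t X : E) : curvatureDual h z t y X = 0 := by
    by_contra hne
    set f : ℝ → ℝ := fun s => α₂ (⟨x, (s • y : E)⟩ : TangentBundle I M) ((0, y) : E × E) with hf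
    have hs (s : ℝ) (hs : s ≠ 0) : s * f s = -1 := by
      have h1 := hws.one_add_mul_apply_curvatureDual I g ha hα x (s • y) t X
      have h2 : curvatureDual h z t (s • y) X = s • curvatureDual h z t y X := by
        have h3 := hh.curvatureDual_add_smul hx t 0 0 X 1
        have h4 := hh.curvatureDual_add_smul hx t 0 y X s
        simp only [smul_zero, add_zero, one_smul, left_eq_add] at h3
        rwa [zero_add, h3, zero_add] at h4
      have h3 : curvatureDual h z t (s • y) X ≠ 0 := by
        rw [h2]; exact smul_ne_zero hs hne
      have h4 := (mul_eq_zero.1 h1).resolve_right (hh.pos z hx _ h3).ne'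
      have h5 : ((0, s • y) : E × E) = s • ((0, y) : E × E) := by simp
      have h6 := (α₂ (⟨x, (s • y : E)⟩ : TangentBundle I M)).map_smul s ((0, y) : E × E)
      rw [h5] at h4
      have h7 : (1 : ℝ) + s * f s = 0 := by
        rw [← smul_eq_mul, hf, ← h6]; exact h4
      linarith
    have hcont : ContinuousAt (fun s => s * f s) 0 :=
      continuousAt_id.mul (continuousAt_oneForm_vlift I hws.smooth₂ x y)
    have hlim : Filter.Tendsto (fun s => s * f s) (nhdsWithin 0 {0}ᶜ) (nhds (0 * f 0)) :=
      hcont.tendsto.mono_left nhdsWithin_le_nhds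
    have hlim' : Filter.Tendsto (fun s => s * f s) (nhdsWithin 0 {0}ᶜ) (nhds (-1)) :=
      tendsto_const_nhds.congr' (by
        filter_upwards [self_mem_nhdsWithin] with s hs' using (hs s hs').symm)
    have := tendsto_nhds_unique hlim hlim'
    simp at this
  refine hh.eq_zero_of_forall hx fun t => ?_
  have h1 := hh.apply_curvatureDual hx t y X W
  rw [hdual] at h1
  simpa using h1.symm

end WeaklySymmetric

end RiemGeom

theorem stmt_15 {E : Type*} [NormedAddCommGroup E] [NormedSpace ℝ E] [FiniteDimensional ℝ E]
    (hn : 3 ≤ Module.finrank ℝ E)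
    {H : Type*} [TopologicalSpace H] (I : ModelWithCorners ℝ E H) [I.Boundaryless]
    {M : Type*} [TopologicalSpace M] [ChartedSpace H M] [IsManifold I ∞ M]
    (g : Bundle.ContMDiffRiemannianMetric I ∞ E (fun x : M => TangentSpace I x))
    (a b c : ℝ) (ha : 0 < a) (hα : 0 < a * (a + c) - b ^ 2)
    (α₁ α₂ : ∀ p : TangentBundle I M, TangentSpace I.tangent p →L[ℝ] ℝ)
    (hws : RiemGeom.IsWeaklySymmetric I.tangent (RiemGeom.gNatural I g.inner a b c) α₁ α₂)
    (p : TangentBundle I M) (X W : TangentSpace I p.proj) :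
    α₂ p (RiemGeom.vlift I p p.snd) • RiemGeom.curvature I g.inner p.proj X W p.snd = 0 := by
  have hR : RiemGeom.curvature I g.inner p.proj X W p.snd = (0 : E) :=
    hws.localCurvature_eq_zero I g ha hα p.proj X W p.snd
  rw [hR]
  exact smul_zero (A := E) _
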